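/- arXiv:1507.06620 — 9 statements merged into one kernel-verified Lean document; each statement's English description precedes it below -/
import Mathlib

section
/- For every integer n ≥ 3, the set T(n) has exactly (n^5 − 2n^3 + n^2)/2 elements; this number equals the genus g of the GK curve over F_{n^6}. -/
/-- Membership condition for the index set `T(n)` of triples `(i,j,k)` indexing the
functions `y^i z^j / x^k` on the GK curve. -/
def memT (n i j k : ℤ) : Prop :=
  0 ≤ i ∧ i ≤ n ∧ 0 ≤ j ∧ j ≤ n ^ 2 - n ∧ 1 ≤ k ∧ k ≤ n ^ 2 - 1 ∧
  (1 ≤ k ∧ k ≤ n - 1 →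
    ((0 ≤ i ∧ i ≤ k ∧ k - i + 1 ≤ j ∧ j ≤ n ^ 2 - n) ∨
     (k + 1 ≤ i ∧ i ≤ n ∧ 0 ≤ j ∧ j ≤ n ^ 2 - n))) ∧
  (n ≤ k ∧ k ≤ n ^ 2 - n - 2 → k - i + 1 ≤ j ∧ j ≤ n ^ 2 - n) ∧
  (n ^ 2 - n - 1 ≤ k ∧ k ≤ n ^ 2 - 1 →
    (k - n ^ 2 + n + 1 ≤ i ∧ i ≤ n ∧ k - i + 1 ≤ j ∧ j ≤ n ^ 2 - n))

/-- The set `T(n)` of triples `(i, j, k)`. -/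
def T (n : ℤ) : Set (ℤ × ℤ × ℤ) := {x | memT n x.1 x.2.1 x.2.2}

theorem aux_row (a b : ℕ) :
    2 * ∑ j ∈ Finset.range (b + 1), (((a + 1 + j - 1 : ℕ)) : ℤ) = (b + 1) * (2 * a + b) := by
  induction b with
  | zero => simp
  | succ b ih =>
    rw [Finset.sum_range_succ, mul_add, ih]
    have : a + 1 + (b + 1) - 1 = a + b + 1 := by omega
    rw [this]; push_cast; ring

theorem aux_zero (b : ℕ) :
    2 * ∑ j ∈ Finset.range (b + 1), (((0 + j - 1 : ℕ)) : ℤ) = b * (b - 1) := by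
  induction b with
  | zero => simp
  | succ b ih =>
    rw [Finset.sum_range_succ, mul_add, ih]
    have : 0 + (b + 1) - 1 = b := by omega
    rw [this]; push_cast; ring

theorem aux_sum (a b : ℕ) :
    2 * ∑ i ∈ Finset.range (a + 1), ∑ j ∈ Finset.range (b + 1), (((i + j - 1 : ℕ)) : ℤ)
      = (a + 1) * (b + 1) * (a + b - 2) + 2 := by
  induction a with
  | zero => rw [Finset.sum_range_one, aux_zero]; push_cast; ring
  | succ a ih =>
    rw [Finset.sum_range_succ, mul_add, ih, aux_row]
    push_cast; ring

def tripleMap (x : Σ _ : ℕ × ℕ, ℕ) : ℤ × ℤ × ℤ := (x.1.1, x.1.2, x.2 + 1)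

theorem tripleMap_inj : Function.Injective tripleMap := by
  rintro ⟨⟨i, j⟩, k⟩ ⟨⟨i2, j2⟩, k2⟩ h
  simp only [tripleMap, Prod.mk.injEq] at h
  obtain ⟨h1, h2, h3⟩ := h
  have e1 : i = i2 := by omega
  have e2 : j = j2 := by omega
  have e3 : k = k2 := by omega
  subst e1 e2 e3
  rfl

theorem memT_iff (n i j k : ℤ) (hn : 3 ≤ n) :
    memT n i j k ↔ 0 ≤ i ∧ i ≤ n ∧ 0 ≤ j ∧ j ≤ n ^ 2 - n ∧ 1 ≤ k ∧ k ≤ i + j - 1 := by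
  unfold memT
  have h : 3 * n ≤ n ^ 2 := by nlinarith
  generalize n ^ 2 = m at *
  omega

theorem T_eq (n m : ℕ) (hn : 3 ≤ n) (hm : (m : ℤ) = (n : ℤ) ^ 2 - n) :
    T n = Set.image tripleMap (((Finset.range (n + 1) ×ˢ Finset.range (m + 1)).sigma
      (fun p => Finset.range (p.1 + p.2 - 1)) : Finset (Σ _ : ℕ × ℕ, ℕ)) :
        Set (Σ _ : ℕ × ℕ, ℕ)) := by
  ext ⟨i, j, k⟩
  simp only [T, Set.mem_ofPred_eq]
  rw [memT_iff _ _ _ _ (by exact_mod_cast hn), ← hm]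
  simp only [Set.mem_image, Finset.mem_coe, Finset.mem_sigma, Finset.mem_product,
    Finset.mem_range, tripleMap, Prod.mk.injEq]
  constructor
  · intro h
    refine ⟨⟨(i.toNat, j.toNat), (k - 1).toNat⟩, ?_, ?_⟩ <;> dsimp only <;> omega
  · rintro ⟨⟨⟨a, b⟩, c⟩, h, h1, h2, h3⟩
    dsimp only at *
    omega

/-- For every integer `n ≥ 3`, the set `T(n)` has exactly
`(n^5 − 2n^3 + n^2)/2` elements (the genus of the GK curve over `F_{n^6}`). -/
theorem card_T (n : ℤ) (hn : 3 ≤ n) :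
    ((T n).ncard : ℤ) = (n ^ 5 - 2 * n ^ 3 + n ^ 2) / 2 := by
  obtain ⟨N, rfl⟩ := Int.eq_ofNat_of_zero_le (show 0 ≤ n by omega)
  have h : (0 : ℤ) ≤ (N : ℤ) ^ 2 - N := by nlinarith
  obtain ⟨m, hm⟩ := Int.eq_ofNat_of_zero_le h
  rw [T_eq N m (by omega) hm.symm, Set.ncard_image_of_injective _ tripleMap_inj,
    Set.ncard_coe_finset, Finset.card_sigma, Finset.sum_product]
  simp only [Finset.card_range]
  have hs := aux_sum N m
  push_cast at hs ⊢
  rw [← hm] at hs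
  symm
  apply Int.ediv_eq_of_eq_mul_right (by norm_num)
  rw [hs]
  ring
end

section
/- For every integer n ≥ 3 and every integer k with 1 ≤ k ≤ n−1, the number of pairs (i,j) such that (i,j,k) ∈ T(n) equals (2n^3 − k^2 − 3k)/2. -/
/-- The triangle of pairs `(i, j)` with `0 ≤ i`, `0 ≤ j`, `i + j ≤ m`. -/
def triangle (m : ℕ) : Finset (ℤ × ℤ) :=
  ((Finset.range (m + 1)).sigma (fun i => Finset.range (i + 1))).image
    (fun x => ((m : ℤ) - x.1, (x.2 : ℤ)))

lemma mem_triangle (m : ℕ) (p : ℤ × ℤ) :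
    p ∈ triangle m ↔ 0 ≤ p.1 ∧ 0 ≤ p.2 ∧ p.1 + p.2 ≤ m := by
  obtain ⟨i, j⟩ := p
  simp only [triangle, Finset.mem_image, Finset.mem_sigma, Finset.mem_range, Prod.mk.injEq]
  constructor
  · rintro ⟨⟨a, b⟩, ⟨h1, h2⟩, h3, h4⟩
    simp only at h1 h2 h3 h4
    omega
  · rintro ⟨h1, h2, h3⟩
    refine ⟨⟨(m - i).toNat, j.toNat⟩, ⟨?_, ?_⟩, ?_, ?_⟩ <;> simp only <;> omega

lemma card_triangle (m : ℕ) : (triangle m).card * 2 = (m + 1) * (m + 2) := by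
  rw [triangle, Finset.card_image_of_injective, Finset.card_sigma]
  · simp only [Finset.card_range]
    induction m with
    | zero => rfl
    | succ m ih => rw [Finset.sum_range_succ, add_mul, ih]; ring
  · rintro ⟨a, b⟩ ⟨c, d⟩ h
    simp only [Prod.mk.injEq] at h
    obtain rfl : a = c := by omega
    obtain rfl : b = d := by omega
    rfl

/-- for `1 ≤ k ≤ n − 1`, the number of pairs `(i,j)` with `(i,j,k) ∈ T(n)`
equals `(2n^3 − k^2 − 3k)/2`. -/
theorem card_Tk_first_range (n k : ℤ) (hn : 3 ≤ n) (hk1 : 1 ≤ k) (hk2 : k ≤ n - 1) :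
    (({p : ℤ × ℤ | memT n p.1 p.2 k}).ncard : ℤ) = (2 * n ^ 3 - k ^ 2 - 3 * k) / 2 := by
  obtain ⟨m, rfl⟩ := Int.eq_ofNat_of_zero_le (show 0 ≤ k by omega)
  have h1 : (n : ℤ) * 3 ≤ n ^ 2 := by nlinarith
  have hsub : triangle m ⊆ Finset.Icc (0 : ℤ) n ×ˢ Finset.Icc (0 : ℤ) (n ^ 2 - n) := by
    intro p hp
    rw [mem_triangle] at hp
    simp only [Finset.mem_product, Finset.mem_Icc]
    omega
  have hset : {p : ℤ × ℤ | memT n p.1 p.2 m} =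
      ((Finset.Icc (0 : ℤ) n ×ˢ Finset.Icc (0 : ℤ) (n ^ 2 - n)) \ triangle m :
        Finset (ℤ × ℤ)) := by
    ext p
    simp only [Set.mem_setOf_eq, Finset.mem_coe, Finset.mem_sdiff, mem_triangle,
      Finset.mem_product, Finset.mem_Icc, memT]
    generalize n ^ 2 = N at *
    omega
  rw [hset, Set.ncard_coe_finset, Finset.card_sdiff_of_subset hsub,
    Nat.cast_sub (Finset.card_le_card hsub), Finset.card_product, Int.card_Icc, Int.card_Icc]
  have hc : ((triangle m).card : ℤ) * 2 = (m + 1) * (m + 2) := by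
    exact_mod_cast card_triangle m
  push_cast
  rw [Int.toNat_of_nonneg (by omega), Int.toNat_of_nonneg (by omega)]
  symm
  apply Int.ediv_eq_of_eq_mul_left (by norm_num)
  linear_combination hc
end

section
/- For every integer n ≥ 3 and every integer k with n^2−n−1 ≤ k ≤ n^2−1, the number of pairs (i,j) such that (i,j,k) ∈ T(n) equals (n^2−k)(n^2−k+1)/2. -/
/-- for `n^2 − n − 1 ≤ k ≤ n^2 − 1`, the number of pairs `(i,j)` with
`(i,j,k) ∈ T(n)` equals `(n^2 − k)(n^2 − k + 1)/2`. -/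
theorem card_Tk_third_range (n k : ℤ) (hn : 3 ≤ n) (hk1 : n ^ 2 - n - 1 ≤ k)
    (hk2 : k ≤ n ^ 2 - 1) :
    (({p : ℤ × ℤ | memT n p.1 p.2 k}).ncard : ℤ) =
      (n ^ 2 - k) * (n ^ 2 - k + 1) / 2 := by
  obtain ⟨m, hm⟩ : ∃ m : ℕ, (m : ℤ) = n ^ 2 - k :=
    ⟨(n ^ 2 - k).toNat, Int.toNat_of_nonneg (by linarith)⟩
  have h9 : 3 * n ≤ n ^ 2 := by nlinarith
  let S : Finset (Σ _ : ℕ, ℕ) := (Finset.range m).sigma (fun u => Finset.range (u + 1))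
  let f : (Σ _ : ℕ, ℕ) → ℤ × ℤ :=
    fun p => (k - n ^ 2 + n + 1 + (p.1 : ℤ), n ^ 2 - n - (p.2 : ℤ))
  have hf : Function.Injective f := by
    rintro ⟨a, b⟩ ⟨c, d⟩ h
    simp only [f, Prod.mk.injEq] at h
    obtain ⟨h1, h2⟩ := h
    have e1 : a = c := by omega
    have e2 : b = d := by omega
    subst e1 e2
    rfl
  have hset : {p : ℤ × ℤ | memT n p.1 p.2 k} = ((S.image f : Finset (ℤ × ℤ)) : Set (ℤ × ℤ)) := by
    ext ⟨i, j⟩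
    simp only [Set.mem_ofPred_eq, Finset.coe_image, Set.mem_image, Finset.mem_coe]
    unfold memT
    constructor
    · rintro ⟨h1, h2, h3, h4, h5, h6, -, -, h7⟩
      obtain ⟨g1, g2, g3, g4⟩ := h7 ⟨hk1, hk2⟩
      refine ⟨⟨(i - (k - n ^ 2 + n + 1)).toNat, (n ^ 2 - n - j).toNat⟩, ?_, ?_⟩
      · simp only [S, Finset.mem_sigma, Finset.mem_range]
        constructor <;> omega
      · simp only [f, Prod.mk.injEq]
        constructor <;> omega
    · rintro ⟨⟨u, v⟩, hS, hE⟩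
      simp only [S, Finset.mem_sigma, Finset.mem_range] at hS
      simp only [f, Prod.mk.injEq] at hE
      obtain ⟨e1, e2⟩ := hE
      obtain ⟨s1, s2⟩ := hS
      refine ⟨?_, ?_, ?_, ?_, ?_, ?_, ?_, ?_, ?_⟩ <;> omega
  have hsum : ∀ m : ℕ, (∑ u ∈ Finset.range m, (u + 1)) * 2 = m * (m + 1) := by
    intro m
    induction m with
    | zero => simp
    | succ m ih => rw [Finset.sum_range_succ, add_mul, ih]; ring
  rw [hset, Set.ncard_coe_finset, Finset.card_image_of_injective _ hf, Finset.card_sigma, ← hm]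
  simp only [Finset.card_range]
  have h := hsum m
  have h' : ((m : ℤ) * (m + 1)) = ((∑ u ∈ Finset.range m, (u + 1) : ℕ) : ℤ) * 2 := by
    exact_mod_cast h.symm
  rw [h', Int.mul_ediv_cancel _ (by norm_num)]
end

section
/- Let n ≥ 3 be an integer. If (i,j,k) and (i',j',k') are integer triples with 0 ≤ i,i' ≤ n, 0 ≤ j,j' ≤ n^2−n, 1 ≤ k,k' ≤ n^2−1, and both k(n^3+1) − i(n^2−n+1) − j = k'(n^3+1) − i'(n^2−n+1) − j' and i(n^3−n^2+n) + j·n^3 − k(n^3+1) = i'(n^3−n^2+n) + j'·n^3 − k'(n^3+1) hold, then (i,j,k) = (i',j',k'). (Hence distinct functions y^i z^j / x^k indexed by distinct triples have distinct pole divisors on the GK curve.) -/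
/-- for `n ≥ 3`, triples `(i,j,k)` and `(i',j',k')` in the box
`0 ≤ i,i' ≤ n`, `0 ≤ j,j' ≤ n^2 − n`, `1 ≤ k,k' ≤ n^2 − 1` with equal pole orders
at `P₀` and at `P∞` coincide. -/
theorem gamma_injOn_box (n i j k i' j' k' : ℤ) (hn : 3 ≤ n)
    (hi : 0 ≤ i) (hi' : 0 ≤ i') (hin : i ≤ n) (hin' : i' ≤ n)
    (hj : 0 ≤ j) (hj' : 0 ≤ j') (hjn : j ≤ n ^ 2 - n) (hjn' : j' ≤ n ^ 2 - n)
    (hk : 1 ≤ k) (hk' : 1 ≤ k') (hkn : k ≤ n ^ 2 - 1) (hkn' : k' ≤ n ^ 2 - 1)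
    (h1 : k * (n ^ 3 + 1) - i * (n ^ 2 - n + 1) - j
        = k' * (n ^ 3 + 1) - i' * (n ^ 2 - n + 1) - j')
    (h2 : i * (n ^ 3 - n ^ 2 + n) + j * n ^ 3 - k * (n ^ 3 + 1)
        = i' * (n ^ 3 - n ^ 2 + n) + j' * n ^ 3 - k' * (n ^ 3 + 1)) :
    i = i' ∧ j = j' ∧ k = k' := by
  have hb : j - j' = (n ^ 2 - n + 1) * ((k - k') * (n + 1) - (i - i')) := by linarith
  have hb0 : j - j' = 0 :=
    Int.eq_zero_of_abs_lt_dvd ⟨_, hb⟩ (by rw [abs_lt]; constructor <;> linarith)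
  have hM : n ^ 2 - n + 1 ≠ 0 := by nlinarith
  have ha : i - i' = (n + 1) * (k - k') := by
    rw [hb0] at hb
    rcases mul_eq_zero.mp hb.symm with h | h
    · exact absurd h hM
    · linarith
  have ha0 : i - i' = 0 :=
    Int.eq_zero_of_abs_lt_dvd ⟨_, ha⟩ (by rw [abs_lt]; constructor <;> linarith)
  have hc : k - k' = 0 := by
    rw [ha0] at ha
    rcases mul_eq_zero.mp ha.symm with h | h
    · linarith
    · exact h
  exact ⟨by linarith, by linarith, by linarith⟩
end

section
/- Let n ≥ 3 be an integer. The map (i,j,k) ↦ k(n^3+1) − i(n^2−n+1) − j is injective on the set of integer triples with 0 ≤ i ≤ n, 0 ≤ j ≤ n^2−n, 1 ≤ k ≤ n^2−1; that is, already the equality of the first coordinates of γ forces (i,j,k) = (i',j',k') for triples in this box. -/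
/-- for `n ≥ 3`, the map `(i,j,k) ↦ k(n^3+1) − i(n^2−n+1) − j` is injective
on the box `0 ≤ i ≤ n`, `0 ≤ j ≤ n^2 − n`, `1 ≤ k ≤ n^2 − 1`. -/
theorem first_coord_injOn_box (n i j k i' j' k' : ℤ) (hn : 3 ≤ n)
    (hi : 0 ≤ i) (hi' : 0 ≤ i') (hin : i ≤ n) (hin' : i' ≤ n)
    (hj : 0 ≤ j) (hj' : 0 ≤ j') (hjn : j ≤ n ^ 2 - n) (hjn' : j' ≤ n ^ 2 - n)
    (hk : 1 ≤ k) (hk' : 1 ≤ k') (hkn : k ≤ n ^ 2 - 1) (hkn' : k' ≤ n ^ 2 - 1)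
    (h : k * (n ^ 3 + 1) - i * (n ^ 2 - n + 1) - j
       = k' * (n ^ 3 + 1) - i' * (n ^ 2 - n + 1) - j') :
    i = i' ∧ j = j' ∧ k = k' := by
  have hm : 0 < n ^ 2 - n + 1 := by nlinarith
  have e : j - j' = (n ^ 2 - n + 1) * ((k - k') * (n + 1) - (i - i')) := by linear_combination -h
  have h1 : j - j' = 0 := Int.eq_zero_of_abs_lt_dvd ⟨_, e⟩ (by rw [abs_lt]; constructor <;> linarith)
  rw [h1] at e
  have e2 : (k - k') * (n + 1) - (i - i') = 0 :=
    (mul_eq_zero.mp e.symm).resolve_left hm.ne'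
  have h2 : i - i' = 0 := Int.eq_zero_of_abs_lt_dvd (m := n + 1) ⟨k - k', by linear_combination -e2⟩
    (by rw [abs_lt]; constructor <;> linarith)
  rw [h2, sub_zero] at e2
  have h3 : k - k' = 0 := (mul_eq_zero.mp e2).resolve_right (by linarith)
  exact ⟨by linarith, by linarith, by linarith⟩
end

section
/- Let n ≥ 3 be an integer. For every triple (i,j,k) ∈ T(n), both coordinates of γ(i,j,k) are positive integers: k(n^3+1) − i(n^2−n+1) − j ≥ 1 and i(n^3−n^2+n) + j·n^3 − k(n^3+1) ≥ 1. -/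
/-- for `(i,j,k) ∈ T(n)`, both coordinates of `γ(i,j,k)` are positive. -/
theorem gamma_pos (n i j k : ℤ) (hn : 3 ≤ n) (h : (i, j, k) ∈ T n) :
    1 ≤ k * (n ^ 3 + 1) - i * (n ^ 2 - n + 1) - j ∧
    1 ≤ i * (n ^ 3 - n ^ 2 + n) + j * n ^ 3 - k * (n ^ 3 + 1) := by
  obtain ⟨h1, h2, h3, h4, h5, h6, ha, hb, hc⟩ : memT n i j k := h
  have key : k + 1 ≤ i + j := by
    by_cases c1 : k ≤ n - 1
    · rcases ha ⟨h5, c1⟩ with h | h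
      · linarith [h.2.2.1]
      · linarith [h.1]
    · by_cases c2 : k ≤ n ^ 2 - n - 2
      · linarith [(hb ⟨by omega, c2⟩).1]
      · linarith [(hc ⟨by omega, h6⟩).2.2.1]
  have hp : 0 ≤ n ^ 2 - n := by nlinarith
  have hq : 0 ≤ n ^ 3 := by positivity
  have e1 := mul_nonneg (sub_nonneg.2 h2) hp
  have e2 := mul_nonneg (sub_nonneg.2 h5) hq
  have e3 := mul_nonneg (sub_nonneg.2 key) hq
  constructor
  · linarith only [e1, e2, h4, h2, h5]
  · linarith only [e1, e3, h6]
end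

section
/- Let n ≥ 3 be an integer. For every triple (i,j,k) ∈ T(n), the positive integer k(n^3+1) − i(n^2−n+1) − j is a gap of S(n): there exist no nonnegative integers a, b, c with k(n^3+1) − i(n^2−n+1) − j = a(n^3+1) + b·n^3 + c(n^3−n^2+n). -/
/-- for `(i,j,k) ∈ T(n)`, the integer `k(n^3+1) − i(n^2−n+1) − j` is a gap
of the numerical semigroup generated by `n^3−n^2+n`, `n^3` and `n^3+1`. -/
theorem first_coord_is_gap (n i j k : ℤ) (hn : 3 ≤ n) (h : (i, j, k) ∈ T n) :
    ¬ ∃ a b c : ℕ, k * (n ^ 3 + 1) - i * (n ^ 2 - n + 1) - j =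
      (a : ℤ) * (n ^ 3 + 1) + (b : ℤ) * n ^ 3 + (c : ℤ) * (n ^ 3 - n ^ 2 + n) := by
  rintro ⟨a, b, c, e⟩
  have ha : (0 : ℤ) ≤ a := Int.natCast_nonneg a
  have hb : (0 : ℤ) ≤ b := Int.natCast_nonneg b
  have hc : (0 : ℤ) ≤ c := Int.natCast_nonneg c
  generalize (a : ℤ) = a at *
  generalize (b : ℤ) = b at *
  generalize (c : ℤ) = c at *
  obtain ⟨hi0, hin, hj0, hjn, hk1, hkn, h1, h2, h3⟩ := h
  simp only at hi0 hin hj0 hjn hk1 hkn h1 h2 h3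
  have hkey : k < i + j := by
    by_cases c1 : k ≤ n - 1
    · rcases h1 ⟨hk1, c1⟩ with h | h <;> linarith [h.1, h.2.1, h.2.2.1]
    · by_cases c2 : k ≤ n ^ 2 - n - 2
      · linarith [(h2 ⟨by omega, c2⟩).1]
      · linarith [(h3 ⟨by omega, hkn⟩).2.2.1]
  obtain ⟨q, hq⟩ : ∃ q, q = n ^ 2 - n + 1 := ⟨_, rfl⟩
  have hqpos : 1 ≤ q := by nlinarith
  -- the difference `b - j` is a multiple `t * q`
  obtain ⟨t, ht⟩ : ∃ t, t = i - c - (k - (a + b + c)) * (n + 1) := ⟨_, rfl⟩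
  have hbt : b = j + t * q := by
    subst hq ht
    linear_combination e
  have ht0 : 0 ≤ t := by
    by_contra hneg
    nlinarith
  -- the degree drop is nonpositive
  have hd : k - (a + b + c) ≤ 0 := by
    by_contra hpos
    nlinarith
  have h4 : 0 ≤ t * (q - 1) := mul_nonneg ht0 (by linarith)
  nlinarith
end

section
/- Let n ≥ 3 be an integer. For every triple (i,j,k) ∈ T(n), the positive integer i(n^3−n^2+n) + j·n^3 − k(n^3+1) is a gap of S(n): there exist no nonnegative integers a, b, c with i(n^3−n^2+n) + j·n^3 − k(n^3+1) = a(n^3+1) + b·n^3 + c(n^3−n^2+n). -/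
/-- for `(i,j,k) ∈ T(n)`, the integer `i(n^3−n^2+n) + j n^3 − k(n^3+1)` is a
gap of the numerical semigroup generated by `n^3−n^2+n`, `n^3` and `n^3+1`. -/
theorem second_coord_is_gap (n i j k : ℤ) (hn : 3 ≤ n) (h : (i, j, k) ∈ T n) :
    ¬ ∃ a b c : ℕ, i * (n ^ 3 - n ^ 2 + n) + j * n ^ 3 - k * (n ^ 3 + 1) =
      (a : ℤ) * (n ^ 3 + 1) + (b : ℤ) * n ^ 3 + (c : ℤ) * (n ^ 3 - n ^ 2 + n) := by
  rintro ⟨a, b, c, he⟩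
  obtain ⟨_, hi, _, hj, hk, -⟩ := h
  simp only at hi hj hk
  have ha : (0 : ℤ) ≤ a := Int.natCast_nonneg a
  have hb : (0 : ℤ) ≤ b := Int.natCast_nonneg b
  have hc : (0 : ℤ) ≤ c := Int.natCast_nonneg c
  generalize (a : ℤ) = a at *
  generalize (b : ℤ) = b at *
  generalize (c : ℤ) = c at *
  have hm : 0 < n ^ 2 - n + 1 := by nlinarith
  obtain ⟨t, ht⟩ : ∃ t, b - j = (n ^ 2 - n + 1) * t :=
    ⟨(a + k) * (n + 1) + (b - j) * (n + 1) + (c - i) * n, by linear_combination he⟩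
  have ht0 : 0 ≤ t := by
    by_contra hneg
    have : t ≤ -1 := by omega
    nlinarith
  have h1 : (a + k) * (n + 1) + t * n ^ 3 + (c - i) * n = 0 := by
    have : (n ^ 2 - n + 1) * ((a + k) * (n + 1) + t * n ^ 3 + (c - i) * n) = 0 := by
      linear_combination -he - n ^ 3 * ht
    exact (mul_eq_zero.mp this).resolve_left (ne_of_gt hm)
  obtain ⟨s, hs⟩ : ∃ s, a + k = n * s :=
    ⟨-(a + k) - t * n ^ 2 - (c - i), by linear_combination h1⟩
  have hs1 : 1 ≤ s := by
    by_contra hneg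
    have : s ≤ 0 := by omega
    nlinarith
  have h2 : s * (n + 1) + t * n ^ 2 + (c - i) = 0 := by
    have : n * (s * (n + 1) + t * n ^ 2 + (c - i)) = 0 := by
      linear_combination h1 - (n + 1) * hs
    exact (mul_eq_zero.mp this).resolve_left (by omega)
  have h3 : 0 ≤ t * n ^ 2 := by positivity
  nlinarith
end

section
/- Let n ≥ 3 be a prime power. The gap set G(n) = ℕ \ S(n) of the numerical semigroup S(n) generated by n^3−n^2+n, n^3 and n^3+1 has exactly (n^5 − 2n^3 + n^2)/2 elements, which is the genus of the GK curve over F_{n^6}. -/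
/-- The map `γ(i,j,k) = (k(n^3+1) − i(n^2−n+1) − j, i(n^3−n^2+n) + j n^3 − k(n^3+1))`,
the pair of pole orders at `P₀` and `P∞` of `y^i z^j / x^k`. -/
def gammaMap (n : ℤ) (x : ℤ × ℤ × ℤ) : ℤ × ℤ :=
  (x.2.2 * (n ^ 3 + 1) - x.1 * (n ^ 2 - n + 1) - x.2.1,
   x.1 * (n ^ 3 - n ^ 2 + n) + x.2.1 * n ^ 3 - x.2.2 * (n ^ 3 + 1))

/-- The gap set `G(n) = ℕ \ S(n)` (viewed inside `ℤ`) of the numerical semigroup `S(n)`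
generated by `n^3 − n^2 + n`, `n^3` and `n^3 + 1`. -/
def Ggaps (n : ℤ) : Set ℤ :=
  {m | 0 ≤ m ∧ ¬ ∃ a b c : ℕ,
    m = (a : ℤ) * (n ^ 3 - n ^ 2 + n) + (b : ℤ) * n ^ 3 + (c : ℤ) * (n ^ 3 + 1)}

/-- Membership in the semigroup `S(n)`. -/
def InS (n m : ℤ) : Prop := ∃ a b c : ℕ,
    m = (a : ℤ) * (n ^ 3 - n ^ 2 + n) + (b : ℤ) * n ^ 3 + (c : ℤ) * (n ^ 3 + 1)

/-- The Frobenius number. -/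
def frob (n : ℤ) : ℤ := n ^ 5 - 2 * n ^ 3 + n ^ 2 - 1

lemma inS_of_int {n m : ℤ} (a b c : ℤ) (ha : 0 ≤ a) (hb : 0 ≤ b) (hc : 0 ≤ c)
    (h : m = a * (n ^ 3 - n ^ 2 + n) + b * n ^ 3 + c * (n ^ 3 + 1)) : InS n m := by
  lift a to ℕ using ha
  lift b to ℕ using hb
  lift c to ℕ using hc
  exact ⟨a, b, c, h⟩

lemma inS_nonneg {n m : ℤ} (hn : 3 ≤ n) (h : InS n m) : 0 ≤ m := by
  obtain ⟨a, b, c, rfl⟩ := h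
  have h1 : 0 ≤ n ^ 3 - n ^ 2 + n := by nlinarith [sq_nonneg n, sq_nonneg (n - 1)]
  have h2 : 0 ≤ n ^ 3 := by positivity
  positivity

lemma inS_add {n m k : ℤ} (h : InS n m) (h' : InS n k) : InS n (m + k) := by
  obtain ⟨a, b, c, rfl⟩ := h
  obtain ⟨a', b', c', rfl⟩ := h'
  exact ⟨a + a', b + b', c + c', by push_cast; ring⟩

lemma frob_not_inS {n : ℤ} (hn : 3 ≤ n) : ¬ InS n (frob n) := by
  rintro ⟨a, b, c, h⟩
  unfold frob at h
  have hq : 0 < n ^ 2 - n + 1 := by nlinarith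
  have hd : (n ^ 2 - n + 1) ∣ ((b : ℤ) + 1) := by
    refine ⟨a * n + (b + 1 + c) * (n + 1) - (n ^ 3 + n ^ 2 - n - 1), ?_⟩
    linear_combination h
  obtain ⟨k, hk⟩ := hd
  have hk1 : 1 ≤ k := by
    by_contra hlt
    have : k ≤ 0 := by omega
    have hb : (0 : ℤ) ≤ b := by positivity
    nlinarith
  have h2 : n ^ 2 - n - 1 = a * n + (k - 1) * n ^ 3 + c * (n + 1) := by
    apply mul_left_cancel₀ hq.ne'
    linear_combination h + n ^ 3 * hk
  have hd2 : n ∣ ((c : ℤ) + 1) :=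
    ⟨n - 1 - a - (k - 1) * n ^ 2 - c, by linear_combination -h2⟩
  have hc : n ≤ (c : ℤ) + 1 := Int.le_of_dvd (by positivity) hd2
  have h3 : 0 ≤ (a : ℤ) * n := by positivity
  have h4 : 0 ≤ (k - 1) * n ^ 3 := mul_nonneg (by omega) (by positivity)
  nlinarith

lemma inS_or {n : ℤ} (hn : 3 ≤ n) (m : ℤ) : InS n m ∨ InS n (frob n - m) := by
  have hq : 0 < n ^ 2 - n + 1 := by nlinarith
  have hn0 : 0 < n := by omega
  set q := n ^ 2 - n + 1 with hqd
  have hb0 := Int.emod_nonneg (-m) hq.ne'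
  have hb1 := Int.emod_lt_of_pos (-m) hq
  have hb := Int.emod_add_mul_ediv (-m) q
  set b := (-m) % q
  set s := (-m) / q
  set t := b * (-(n + 1)) - s with ht
  have hm : m = b * n ^ 3 + q * t := by
    rw [ht]; linear_combination hb + b * (n + 1) * hqd
  have hc0 := Int.emod_nonneg t hn0.ne'
  have hc1 := Int.emod_lt_of_pos t hn0
  have hc := Int.emod_add_mul_ediv t n
  set c := t % n
  set u := t / n
  have hm2 : m = (u - c) * (n ^ 3 - n ^ 2 + n) + b * n ^ 3 + c * (n ^ 3 + 1) := by
    rw [hm, ← hc, hqd]; ring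
  rcases le_or_gt 0 (u - c) with h | h
  · exact .inl (inS_of_int _ _ _ h hb0 hc0 hm2)
  · refine .inr (inS_of_int (-1 - (u - c)) (q - 1 - b) (n - 1 - c) (by omega) (by omega)
      (by omega) ?_)
    rw [hm2, frob, hqd]; ring

lemma inS_iff {n : ℤ} (hn : 3 ≤ n) (m : ℤ) : InS n (frob n - m) ↔ ¬ InS n m := by
  constructor
  · intro h h'
    apply frob_not_inS hn
    simpa using inS_add h h'
  · intro h
    exact (inS_or hn m).resolve_left h

/-- for a prime power `n ≥ 3`, the gap set of the numerical semigroup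
generated by `n^3 − n^2 + n`, `n^3` and `n^3 + 1` has exactly `(n^5 − 2n^3 + n^2)/2`
elements, the genus of the GK curve over `F_{n^6}`. -/
theorem card_gaps (n : ℕ) (hn : 3 ≤ n) (hpp : IsPrimePow n) :
    ((Ggaps (n : ℤ)).ncard : ℤ) =
      ((n : ℤ) ^ 5 - 2 * (n : ℤ) ^ 3 + (n : ℤ) ^ 2) / 2 := by
  have hn' : (3 : ℤ) ≤ n := by exact_mod_cast hn
  generalize (n : ℤ) = N at *
  classical
  have hF : 0 ≤ frob N + 1 := by
    have : frob N + 1 = N ^ 2 * (N * (N ^ 2 - 2) + 1) := by unfold frob; ring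
    rw [this]
    have : 0 ≤ N ^ 2 - 2 := by nlinarith
    have : 0 ≤ N := by omega
    positivity
  have hG : Ggaps N = ↑((Finset.Icc 0 (frob N)).filter (fun m => ¬ InS N m)) := by
    ext m
    simp only [Finset.coe_filter, Finset.mem_Icc, Set.mem_ofPred_eq]
    constructor
    · rintro ⟨h0, h⟩
      have := inS_nonneg hn' ((inS_iff hn' m).2 h)
      exact ⟨⟨h0, by omega⟩, h⟩
    · rintro ⟨⟨h0, _⟩, h⟩
      exact ⟨h0, h⟩
  rw [hG, Set.ncard_coe_finset]
  have hs := Finset.card_filter_add_card_filter_not (s := Finset.Icc 0 (frob N)) (fun m => InS N m)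
  have he : ((Finset.Icc 0 (frob N)).filter (fun m => InS N m)).card
      = ((Finset.Icc 0 (frob N)).filter (fun m => ¬ InS N m)).card := by
    apply Finset.card_nbij' (fun m => frob N - m) (fun m => frob N - m)
    · intro m hm
      simp only [Finset.coe_filter, Finset.mem_Icc, Set.mem_ofPred_eq] at hm ⊢
      refine ⟨by omega, ?_⟩
      rw [inS_iff hn', not_not]; exact hm.2
    · intro m hm
      simp only [Finset.coe_filter, Finset.mem_Icc, Set.mem_ofPred_eq] at hm ⊢
      exact ⟨by omega, (inS_iff hn' m).2 hm.2⟩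
    · intro m _; simp
    · intro m _; simp
  rw [he, Int.card_Icc] at hs
  have h5 : N ^ 5 - 2 * N ^ 3 + N ^ 2 = frob N + 1 := by unfold frob; ring
  rw [h5]
  omega
end
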